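/- arXiv:2301.02870 — 14 statements merged into one kernel-verified Lean document; each statement's English description precedes it below -/
import Mathlib

section
/- Let ε, s ∈ (0,1) and set ξ = s·ε/(1+ε). Let R > 0, N ∈ ℕ, and let r_0, r_1, …, r_N and L_0, …, L_{N−1} be nonnegative real numbers with r_0 = 0 and r_i ≤ R for every i ≤ N. Suppose that for every i < N both inequalities hold: r_{i+1} ≥ √(r_i² + L_i²) and r_{i+1} ≥ (1+ε)·R − L_i − ξ·r_i. Then N < 2/((1−s)·ε). -/
/-- If `x` dominates both `√(r² + L²)` and `A - L - ξ r`, then it exceeds `r` by at least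
`(A - (1 + ξ) r)² / (2 A)`. -/
theorem sq_gap_le_two_mul_radius_increase {A ξ r L x : ℝ} (hξ : 0 ≤ ξ) (hr : 0 ≤ r)
    (hgap : 0 ≤ A - (1 + ξ) * r)
    (hsqrt : Real.sqrt (r ^ 2 + L ^ 2) ≤ x) (hlin : A - L - ξ * r ≤ x) :
    (A - (1 + ξ) * r) ^ 2 ≤ 2 * A * (x - r) := by
  have hrx : r ≤ x :=
    (Real.le_sqrt hr (by positivity)).2 (by nlinarith [sq_nonneg L]) |>.trans hsqrt
  have hsq : r ^ 2 + L ^ 2 ≤ x ^ 2 := (Real.sqrt_le_left (hr.trans hrx)).1 hsqrt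
  have hξr : 0 ≤ ξ * r := mul_nonneg hξ hr
  have hmono : 0 ≤ (ξ * r) * (x - r) := mul_nonneg hξr (sub_nonneg.2 hrx)
  rcases le_total (A - ξ * r) x with h | h
  · have hA : A - (1 + ξ) * r ≤ A := by linarith
    have hx : A - (1 + ξ) * r ≤ x - r := by linarith
    have := mul_le_mul hA hx hgap (hgap.trans hA)
    have := mul_nonneg (hgap.trans hA) (sub_nonneg.2 hrx)
    linarith
  · have hL : (A - ξ * r - x) ^ 2 ≤ L ^ 2 := by
      apply pow_le_pow_left₀ <;> linarith
    linarith

/-- Reciprocals of a sequence decreasing as `u' ≤ u - c u²` grow at least linearly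
with slope `c`. -/
theorem mul_add_le_one_of_le_sub_sq {u v c k : ℝ} (hc : 0 ≤ c) (hk : 0 ≤ k) (hcu : c * u ≤ 1)
    (huk : u * k ≤ 1) (hv : v ≤ u - c * u ^ 2) : v * (k + c) ≤ 1 := by
  have h₁ := mul_le_mul_of_nonneg_right hv (add_nonneg hk hc)
  have h₂ := mul_nonneg (sub_nonneg.2 huk) (sub_nonneg.2 hcu)
  linarith [sq_nonneg (c * u)]


/-- Theorem 1 of the paper: size bound for the Bădoiu–Clarkson core-set construction
when each iteration only computes an approximate MEB center within distance `ξ·rᵢ`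
of the exact center.  `rᵢ` is the exact MEB radius of the core-set in round `i`,
`Lᵢ` is the shift of the exact center between rounds, and `R` plays the role of
`Rad(P)`.  The two recurrences are inequality (3) of the paper, and the conclusion
bounds the number of iterations by `2/((1-s)·ε)`. -/
theorem coreset_size_bound
    (ε s ξ R : ℝ) (hε0 : 0 < ε) (hε1 : ε < 1) (hs0 : 0 < s) (hs1 : s < 1)
    (hξ : ξ = s * ε / (1 + ε)) (hR : 0 < R)
    (N : ℕ) (r L : ℕ → ℝ)
    (hr0 : r 0 = 0)
    (hrnn : ∀ i, i ≤ N → 0 ≤ r i)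
    (hLnn : ∀ i, i < N → 0 ≤ L i)
    (hrR : ∀ i, i ≤ N → r i ≤ R)
    (hgrow1 : ∀ i, i < N → Real.sqrt ((r i) ^ 2 + (L i) ^ 2) ≤ r (i + 1))
    (hgrow2 : ∀ i, i < N → (1 + ε) * R - L i - ξ * r i ≤ r (i + 1)) :
    (N : ℝ) < 2 / ((1 - s) * ε) := by
  have hε : 0 < 1 + ε := by linarith
  have hξε : ξ * (1 + ε) = s * ε := by rw [hξ]; field_simp
  have hξ0 : 0 ≤ ξ := by rw [hξ]; positivity
  have hξlt : ξ < ε := by nlinarith [mul_pos hε0 (sub_pos.2 hs1)]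
  set A := (1 + ε) * R with hAdef
  have hA : 0 < A := mul_pos hε hR
  have hgap : ∀ i, i ≤ N → 0 ≤ A - (1 + ξ) * r i := fun i hi => by
    have := mul_le_mul (by linarith : 1 + ξ ≤ 1 + ε) (hrR i hi) (hrnn i hi) hε.le
    linarith
  have hrec : ∀ i, i ≤ N → (1 - (1 + ξ) * r i / A) * (1 + i * ((1 + ξ) / 2)) ≤ 1 := by
    intro i
    induction i with
    | zero => intro _; simp [hr0]
    | succ i ih =>
      intro hi
      have hstep := sq_gap_le_two_mul_radius_increase hξ0 (hrnn i (by lia)) (hgap i (by lia))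
        (hgrow1 i (by lia)) (hgrow2 i (by lia))
      have hu1 : 1 - (1 + ξ) * r i / A ≤ 1 := by
        have := hrnn i (by lia)
        have : 0 ≤ (1 + ξ) * r i / A := by positivity
        linarith
      have hcu : (1 + ξ) / 2 * (1 - (1 + ξ) * r i / A) ≤ 1 := by
        nlinarith [mul_le_mul_of_nonneg_left hu1 (by positivity : 0 ≤ (1 + ξ) / 2)]
      have hv : 1 - (1 + ξ) * r (i + 1) / A ≤ (1 - (1 + ξ) * r i / A) -
          (1 + ξ) / 2 * (1 - (1 + ξ) * r i / A) ^ 2 := by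
        have key : (1 - (1 + ξ) * r i / A) - (1 + ξ) / 2 * (1 - (1 + ξ) * r i / A) ^ 2 -
            (1 - (1 + ξ) * r (i + 1) / A) =
            (1 + ξ) / (2 * A ^ 2) *
              (2 * A * (r (i + 1) - r i) - (A - (1 + ξ) * r i) ^ 2) := by
          field_simp
          ring
        have := mul_nonneg (by positivity : 0 ≤ (1 + ξ) / (2 * A ^ 2)) (sub_nonneg.2 hstep)
        linarith
      have := mul_add_le_one_of_le_sub_sq (by positivity) (by positivity) hcu
        (ih (by lia)) hv
      push_cast
      linarith
  have hN := hrec N le_rfl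
  have hlast : ε * (1 - s + ε) / (1 + ε) ^ 2 ≤ 1 - (1 + ξ) * r N / A := by
    have h : (1 + ξ) * r N / A ≤ (1 + ξ) * R / A := by
      have := hrR N le_rfl
      gcongr
    have e : 1 - (1 + ξ) * R / A = ε * (1 - s + ε) / (1 + ε) ^ 2 := by
      rw [hAdef, hξ]
      field_simp
      ring
    linarith
  have hfin : ε * (1 - s + ε) / (1 + ε) ^ 2 * (1 + N * ((1 + ξ) / 2)) ≤ 1 :=
    (mul_le_mul_of_nonneg_right hlast (by positivity)).trans hN
  have hs : 0 < 1 - s := sub_pos.2 hs1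
  have hbound : (N : ℝ) ≤ 2 * (1 + ε) / (ε * (1 - s + ε)) := by
    rw [le_div_iff₀ (by positivity)]
    have e : ε * (1 - s + ε) / (1 + ε) ^ 2 * (1 + N * ((1 + ξ) / 2)) - 1 =
        (1 + ε + s * ε) / (2 * (1 + ε) ^ 3) *
          (N * (ε * (1 - s + ε)) - 2 * (1 + ε)) := by
      rw [hξ]
      field_simp
      ring
    have hpos : 0 < (1 + ε + s * ε) / (2 * (1 + ε) ^ 3) := by positivity
    by_contra! h
    linarith [mul_pos hpos (sub_pos.2 h)]
  refine hbound.trans_lt ?_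
  rw [div_lt_div_iff₀ (by positivity) (by positivity)]
  have : 0 < ε * (ε * s) := by positivity
  linarith
end

section
/- Let P′ be a finite nonempty subset of E with MEB center o′ and radius r′ = Rad(P′) (so P′ ⊆ closedBall(o′, r′) and every closed ball containing P′ has radius at least r′). Let o ∈ E and R ≥ 0 with P′ ⊆ closedBall(o, R), and let a ∈ E satisfy ‖a − o′‖ = r′ and ‖a − o‖ = R. Then ⟪a − o′, o − o′⟫ ≤ 0; that is, the angle ∠ a o′ o is at least π/2. -/
open Metric
open scoped RealInnerProductSpace

/-- Squared distance from `p` to the point `x + t • (y - x)` of the line through `x` and `y`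
(Stewart's theorem). -/
theorem norm_sub_add_smul_sq {E : Type*} [NormedAddCommGroup E] [InnerProductSpace ℝ E]
    (p x y : E) (t : ℝ) :
    ‖p - (x + t • (y - x))‖ ^ 2 =
      (1 - t) * ‖p - x‖ ^ 2 + t * ‖p - y‖ ^ 2 - t * (1 - t) * ‖y - x‖ ^ 2 := by
  have h₁ : p - (x + t • (y - x)) = (p - x) - t • (y - x) := by abel
  have h₂ : p - y = (p - x) - (y - x) := by abel
  rw [h₁, h₂, norm_sub_sq_real (p - x) (t • (y - x)), norm_sub_sq_real (p - x) (y - x),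
    real_inner_smul_right, norm_smul, mul_pow, Real.norm_eq_abs, sq_abs]
  ring

/-- Claim 1 of the paper: if `o'` is the MEB center of a finite nonempty set `P'`
with radius `r' = Rad(P')`, `P' ⊆ closedBall o R`, and `a` is a point on the
intersection of the two spheres (`‖a - o'‖ = r'` and `‖a - o‖ = R`), then the
angle `∠ a o' o` is at least `π/2`, i.e. `⟪a - o', o - o'⟫ ≤ 0`. -/
theorem claim_angle {d : ℕ} (hd : 1 ≤ d)
    (P' : Finset (EuclideanSpace ℝ (Fin d))) (hP' : P'.Nonempty)
    (o' : EuclideanSpace ℝ (Fin d)) (r' : ℝ)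
    (hcenter : (P' : Set (EuclideanSpace ℝ (Fin d))) ⊆ closedBall o' r')
    (hmin : ∀ (c : EuclideanSpace ℝ (Fin d)) (ρ : ℝ),
      (P' : Set (EuclideanSpace ℝ (Fin d))) ⊆ closedBall c ρ → r' ≤ ρ)
    (o : EuclideanSpace ℝ (Fin d)) (R : ℝ) (hR : 0 ≤ R)
    (hcover : (P' : Set (EuclideanSpace ℝ (Fin d))) ⊆ closedBall o R)
    (a : EuclideanSpace ℝ (Fin d)) (ha1 : ‖a - o'‖ = r') (ha2 : ‖a - o‖ = R) :
    ⟪a - o', o - o'⟫ ≤ 0 := by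
  by_contra! hs
  have ha : R ^ 2 = r' ^ 2 - 2 * ⟪a - o', o - o'⟫ + ‖o - o'‖ ^ 2 := by
    rw [← ha1, ← ha2, ← norm_sub_sq_real, sub_sub_sub_cancel_right]
  set s := ⟪a - o', o - o'⟫
  set w := ‖o - o'‖ ^ 2
  have hw : 0 ≤ w := sq_nonneg _
  obtain ⟨t, ht0, ht1, htw⟩ : ∃ t : ℝ, 0 < t ∧ t ≤ 1 ∧ t * w ≤ s := by
    refine ⟨s / (s + w), by positivity, ?_, ?_⟩
    · rw [div_le_one (by positivity)]
      linarith
    · rw [div_mul_eq_mul_div, div_le_iff₀ (by positivity)]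
      nlinarith
  have hr : 0 ≤ r' := ha1 ▸ norm_nonneg _
  have hdist : ∀ p ∈ P', ‖p - (o' + t • (o - o'))‖ ^ 2 ≤ r' ^ 2 - t * s := by
    intro p hp
    have h₁ : ‖p - o'‖ ^ 2 ≤ r' ^ 2 :=
      pow_le_pow_left₀ (norm_nonneg _) (mem_closedBall_iff_norm.1 (hcenter hp)) 2
    have h₂ : ‖p - o‖ ^ 2 ≤ R ^ 2 :=
      pow_le_pow_left₀ (norm_nonneg _) (mem_closedBall_iff_norm.1 (hcover hp)) 2
    rw [norm_sub_add_smul_sq]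
    calc (1 - t) * ‖p - o'‖ ^ 2 + t * ‖p - o‖ ^ 2 - t * (1 - t) * w
        ≤ (1 - t) * r' ^ 2 + t * R ^ 2 - t * (1 - t) * w := by
          have := sub_nonneg.2 ht1
          gcongr
      _ = r' ^ 2 - 2 * (t * s) + t * (t * w) := by rw [ha]; ring
      _ ≤ r' ^ 2 - t * s := by linarith [mul_le_mul_of_nonneg_left htw ht0.le]
  have hle : r' ≤ √(r' ^ 2 - t * s) := hmin (o' + t • (o - o')) _ fun p hp =>
    mem_closedBall_iff_norm.2 (Real.le_sqrt_of_sq_le (hdist p hp))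
  obtain ⟨p, hp⟩ := hP'
  have hsq := (Real.le_sqrt hr ((sq_nonneg _).trans (hdist p hp))).1 hle
  linarith [mul_pos ht0 hs]
end

section
/- Let P′ be a finite nonempty subset of E with MEB center o′ and radius r′ = Rad(P′). If P′ ⊆ closedBall(o, R) for some o ∈ E and R ≥ 0, then ‖o − o′‖² ≤ R² − r′². -/
open Metric

/-- Stewart's identity for the point `o' + t • (o - o')` on the line through `o'` and `o`. -/
theorem norm_sub_add_smul_sub_sq {E : Type*} [NormedAddCommGroup E] [InnerProductSpace ℝ E]
    (p o o' : E) (t : ℝ) :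
    ‖p - (o' + t • (o - o'))‖ ^ 2 =
      (1 - t) * ‖p - o'‖ ^ 2 + t * ‖p - o‖ ^ 2 - t * (1 - t) * ‖o - o'‖ ^ 2 := by
  have h₁ : p - (o' + t • (o - o')) = (p - o') - t • (o - o') := by abel
  have h₂ : p - o = (p - o') - (o - o') := by abel
  rw [h₁, h₂, norm_sub_sq_real, norm_sub_sq_real (p - o') (o - o'), inner_smul_right, norm_smul,
    mul_pow, Real.norm_eq_abs, sq_abs]
  ring

/-- The key geometric inequality from the proof of Lemma 1 of the paper:
if `o'` is the MEB center of a finite nonempty set `P'` with radius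
`r' = Rad(P')` and `P' ⊆ closedBall o R`, then `‖o - o'‖² ≤ R² - r'²`. -/
theorem center_distance_sq_bound {d : ℕ} (hd : 1 ≤ d)
    (P' : Finset (EuclideanSpace ℝ (Fin d))) (hP' : P'.Nonempty)
    (o' : EuclideanSpace ℝ (Fin d)) (r' : ℝ)
    (hcenter : (P' : Set (EuclideanSpace ℝ (Fin d))) ⊆ closedBall o' r')
    (hmin : ∀ (c : EuclideanSpace ℝ (Fin d)) (ρ : ℝ),
      (P' : Set (EuclideanSpace ℝ (Fin d))) ⊆ closedBall c ρ → r' ≤ ρ)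
    (o : EuclideanSpace ℝ (Fin d)) (R : ℝ) (hR : 0 ≤ R)
    (hcover : (P' : Set (EuclideanSpace ℝ (Fin d))) ⊆ closedBall o R) :
    ‖o - o'‖ ^ 2 ≤ R ^ 2 - r' ^ 2 := by
  have hr' : 0 ≤ r' := by
    obtain ⟨p, hp⟩ := hP'
    exact dist_nonneg.trans (mem_closedBall.1 (hcenter hp))
  have hrR : r' ^ 2 ≤ R ^ 2 := pow_le_pow_left₀ hr' (hmin o R hcover) 2
  have key : ∀ t : ℝ, 0 < t → t ≤ 1 → r' ^ 2 ≤ R ^ 2 - (1 - t) * ‖o - o'‖ ^ 2 := by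
    intro t ht ht1
    set b := (1 - t) * r' ^ 2 + t * R ^ 2 - t * (1 - t) * ‖o - o'‖ ^ 2 with hb
    have hpb : ∀ p ∈ P', ‖p - (o' + t • (o - o'))‖ ^ 2 ≤ b := by
      intro p hp
      have h₁ : ‖p - o'‖ ^ 2 ≤ r' ^ 2 :=
        pow_le_pow_left₀ (norm_nonneg _) (mem_closedBall_iff_norm.1 (hcenter hp)) 2
      have h₂ : ‖p - o‖ ^ 2 ≤ R ^ 2 :=
        pow_le_pow_left₀ (norm_nonneg _) (mem_closedBall_iff_norm.1 (hcover hp)) 2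
      rw [norm_sub_add_smul_sub_sq, hb]
      have : 0 ≤ 1 - t := sub_nonneg.2 ht1
      gcongr
    have hb0 : 0 ≤ b := by
      obtain ⟨p, hp⟩ := hP'
      exact (sq_nonneg _).trans (hpb p hp)
    have hle : r' ≤ √b := hmin (o' + t • (o - o')) _ fun p hp =>
      mem_closedBall_iff_norm.2 (Real.le_sqrt_of_sq_le (hpb p hp))
    have hsq : r' ^ 2 ≤ b := (Real.le_sqrt hr' hb0).1 hle
    refine le_of_mul_le_mul_left ?_ ht
    linarith
  by_contra! h
  have hD : 0 < ‖o - o'‖ ^ 2 := by linarith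
  set e := ‖o - o'‖ ^ 2 - (R ^ 2 - r' ^ 2)
  have ht := key (e / (2 * ‖o - o'‖ ^ 2)) (div_pos (by linarith) (by linarith))
    ((div_le_one (by linarith)).2 (by linarith))
  have hmul : e / (2 * ‖o - o'‖ ^ 2) * ‖o - o'‖ ^ 2 = e / 2 := by
    have hD' : ‖o - o'‖ ≠ 0 := pow_ne_zero_iff two_ne_zero |>.1 hD.ne'
    field_simp
  linarith
end

section
/- Let ε ∈ (0,1). Let P ⊆ E be finite and nonempty with MEB center o and radius R = Rad(P), and let P′ ⊆ P be nonempty with MEB center o′ and radius r′ = Rad(P′). If r′ ≥ (1−ε²)·R, then ‖o′ − o‖ ≤ √2·ε·R. -/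
open Metric

/-- Stewart's identity: the squared distance from a point to a point of a segment. -/
theorem norm_sub_sub_smul_sq {E : Type*} [NormedAddCommGroup E] [InnerProductSpace ℝ E]
    (p a b : E) (t : ℝ) :
    ‖p - (a + t • (b - a))‖ ^ 2 =
      (1 - t) * ‖p - a‖ ^ 2 + t * ‖p - b‖ ^ 2 - t * (1 - t) * ‖a - b‖ ^ 2 := by
  have h1 : p - (a + t • (b - a)) = (p - a) - t • ((p - a) - (p - b)) := by
    rw [sub_sub_sub_cancel_left]; abel
  have h2 : a - b = (p - b) - (p - a) := by abel
  rw [h1, h2]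
  generalize p - a = u
  generalize p - b = v
  rw [norm_sub_sq_real, norm_smul, inner_smul_right, mul_pow, Real.norm_eq_abs, sq_abs,
    inner_sub_right, norm_sub_sq_real, norm_sub_sq_real, real_inner_self_eq_norm_sq,
    real_inner_comm u v]
  ring

/-- If `a` is the center of a minimum enclosing ball of `S`, of radius `r`, then the center `b`
of any ball of radius `R` containing `S` satisfies `‖a - b‖² + r² ≤ R²`. -/
theorem norm_sub_sq_add_sq_le_of_minimal {E : Type*} [NormedAddCommGroup E]
    [InnerProductSpace ℝ E] {S : Set E} (hS : S.Nonempty) {a b : E} {r R : ℝ}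
    (ha : S ⊆ closedBall a r) (hmin : ∀ (c : E) (ρ : ℝ), S ⊆ closedBall c ρ → r ≤ ρ)
    (hb : S ⊆ closedBall b R) :
    ‖a - b‖ ^ 2 + r ^ 2 ≤ R ^ 2 := by
  obtain ⟨q, hq⟩ := hS
  have hr : 0 ≤ r := dist_nonneg.trans (mem_closedBall.1 (ha hq))
  have key : ∀ t : ℝ, 0 < t → t < 1 → r ^ 2 + (1 - t) * ‖a - b‖ ^ 2 ≤ R ^ 2 := by
    intro t ht0 ht1
    set X := (1 - t) * r ^ 2 + t * R ^ 2 - t * (1 - t) * ‖a - b‖ ^ 2 with hX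
    have hball : ∀ p ∈ S, ‖p - (a + t • (b - a))‖ ^ 2 ≤ X := by
      intro p hp
      have h1 : ‖p - a‖ ≤ r := mem_closedBall_iff_norm.1 (ha hp)
      have h2 : ‖p - b‖ ≤ R := mem_closedBall_iff_norm.1 (hb hp)
      have h3 : 0 ≤ 1 - t := by linarith
      rw [norm_sub_sub_smul_sq, hX]
      gcongr
    have hX0 : 0 ≤ X := (sq_nonneg _).trans (hball q hq)
    have hrX : r ≤ √X := hmin (a + t • (b - a)) _ fun p hp =>
      mem_closedBall_iff_norm.2 (Real.le_sqrt_of_sq_le (hball p hp))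
    have hrX2 : r ^ 2 ≤ X := (Real.le_sqrt hr hX0).1 hrX
    refine le_of_mul_le_mul_left ?_ ht0
    linarith
  by_contra! h
  set D := ‖a - b‖ ^ 2
  have hD : 0 ≤ D := sq_nonneg _
  obtain ⟨δ, hδ⟩ : ∃ δ, δ = D + r ^ 2 - R ^ 2 := ⟨_, rfl⟩
  have hδ0 : 0 < δ := by linarith
  have hk := key (δ / (2 * (D + δ))) (by positivity)
    ((div_lt_one (by positivity)).2 (by linarith))
  have hlt : δ / (2 * (D + δ)) * D < δ := by
    rw [div_mul_eq_mul_div, div_lt_iff₀ (by positivity)]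
    nlinarith [mul_nonneg hδ0.le hD]
  linarith

/-- Lemma 1 of the paper: let `o` be the MEB center of a finite nonempty set `P`
with radius `R = Rad(P)`, and `o'` the MEB center of a nonempty subset `P' ⊆ P`
with radius `r' = Rad(P')`.  If `r' ≥ (1 - ε²)·R` then `‖o' - o‖ ≤ √2·ε·R`. -/
theorem subset_center_close {d : ℕ} (hd : 1 ≤ d)
    (ε : ℝ) (hε0 : 0 < ε) (hε1 : ε < 1)
    (P : Finset (EuclideanSpace ℝ (Fin d))) (hP : P.Nonempty)
    (o : EuclideanSpace ℝ (Fin d)) (R : ℝ)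
    (hocover : (P : Set (EuclideanSpace ℝ (Fin d))) ⊆ closedBall o R)
    (homin : ∀ (c : EuclideanSpace ℝ (Fin d)) (ρ : ℝ),
      (P : Set (EuclideanSpace ℝ (Fin d))) ⊆ closedBall c ρ → R ≤ ρ)
    (P' : Finset (EuclideanSpace ℝ (Fin d))) (hP'P : P' ⊆ P) (hP' : P'.Nonempty)
    (o' : EuclideanSpace ℝ (Fin d)) (r' : ℝ)
    (ho'cover : (P' : Set (EuclideanSpace ℝ (Fin d))) ⊆ closedBall o' r')
    (ho'min : ∀ (c : EuclideanSpace ℝ (Fin d)) (ρ : ℝ),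
      (P' : Set (EuclideanSpace ℝ (Fin d))) ⊆ closedBall c ρ → r' ≤ ρ)
    (hr' : (1 - ε ^ 2) * R ≤ r') :
    ‖o' - o‖ ≤ Real.sqrt 2 * ε * R := by
  obtain ⟨q, hq⟩ := hP
  have hR : 0 ≤ R := dist_nonneg.trans (mem_closedBall.1 (hocover hq))
  have h := norm_sub_sq_add_sq_le_of_minimal (Finset.coe_nonempty.2 hP') ho'cover ho'min
    ((Finset.coe_subset.2 hP'P).trans hocover)
  have hε : 0 ≤ 1 - ε ^ 2 := by nlinarith
  have hsq : ((1 - ε ^ 2) * R) ^ 2 ≤ r' ^ 2 := by gcongr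
  refine (abs_le_of_sq_le_sq' ?_ (by positivity)).2
  rw [mul_pow, mul_pow, Real.sq_sqrt zero_le_two]
  nlinarith [sq_nonneg (ε ^ 2 * R)]
end

section
/- Let ε, ε′ ∈ (0,1) and R_P > 0. Let P′ ⊆ E be finite and nonempty with MEB center o′ and radius r′ = Rad(P′), and suppose r′ ≥ (1−ε²)·R_P. Let õ ∈ E and r ≥ 0 with P′ ⊆ closedBall(õ, r) and r ≤ (1+ε′²)·R_P. Then ‖õ − o′‖ < (√2·ε + √3·ε′)·R_P. -/
open Metric

theorem norm_sub_smul_sq {E : Type*} [NormedAddCommGroup E] [InnerProductSpace ℝ E]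
    (u v : E) (t : ℝ) :
    ‖u - t • v‖ ^ 2 = (1 - t) * ‖u‖ ^ 2 + t * ‖u - v‖ ^ 2 - t * (1 - t) * ‖v‖ ^ 2 := by
  rw [norm_sub_sq_real, norm_sub_sq_real, inner_smul_right, norm_smul, mul_pow,
    Real.norm_eq_abs, sq_abs]
  ring

/-- A ball of radius `ρ` covering `s` has its center at distance at most `√(ρ² - R²)` from the
center of a minimum enclosing ball of radius `R`. -/
theorem norm_sub_sq_le_of_minimal_closedBall {E : Type*} [NormedAddCommGroup E]
    [InnerProductSpace ℝ E] {s : Set E} (hs : s.Nonempty) {o c : E} {R ρ : ℝ}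
    (ho : s ⊆ closedBall o R) (hmin : ∀ x τ, s ⊆ closedBall x τ → R ≤ τ)
    (hc : s ⊆ closedBall c ρ) : ‖c - o‖ ^ 2 ≤ ρ ^ 2 - R ^ 2 := by
  obtain ⟨p₀, hp₀⟩ := hs
  have hR : 0 ≤ R := dist_nonneg.trans (mem_closedBall.1 (ho hp₀))
  by_contra! h
  set δ := ‖c - o‖ ^ 2 - (ρ ^ 2 - R ^ 2) with hδ
  have hδ0 : 0 < δ := by linarith
  have hden : 0 < δ + ‖c - o‖ ^ 2 + 1 := by positivity
  obtain ⟨t, ht⟩ : ∃ t, t = δ / (δ + ‖c - o‖ ^ 2 + 1) := ⟨_, rfl⟩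
  have ht0 : 0 < t := ht ▸ div_pos hδ0 hden
  have htmul : t * (δ + ‖c - o‖ ^ 2 + 1) = δ := by rw [ht]; exact div_mul_cancel₀ _ hden.ne'
  have ht1 : t < 1 := by rw [ht, div_lt_one hden]; nlinarith [sq_nonneg ‖c - o‖]
  have htD : t * ‖c - o‖ ^ 2 < δ := by nlinarith [mul_pos ht0 hδ0]
  set S := (1 - t) * R ^ 2 + t * ρ ^ 2 - t * (1 - t) * ‖c - o‖ ^ 2 with hS
  have key : ∀ p ∈ s, ‖p - (o + t • (c - o))‖ ^ 2 ≤ S := by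
    intro p hp
    have h₁ : ‖p - o‖ ^ 2 ≤ R ^ 2 := by
      gcongr
      simpa [dist_eq_norm] using ho hp
    have h₂ : ‖p - c‖ ^ 2 ≤ ρ ^ 2 := by
      gcongr
      simpa [dist_eq_norm] using hc hp
    have h₃ := norm_sub_smul_sq (p - o) (c - o) t
    rw [sub_sub_sub_cancel_right, sub_sub] at h₃
    rw [h₃]
    have := mul_le_mul_of_nonneg_left h₁ (sub_nonneg.2 ht1.le)
    have := mul_le_mul_of_nonneg_left h₂ ht0.le
    linarith
  have hS0 : 0 ≤ S := (sq_nonneg _).trans (key p₀ hp₀)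
  have hRS : R ≤ √S := hmin (o + t • (c - o)) _ fun p hp => by
    rw [mem_closedBall, dist_eq_norm]
    exact Real.le_sqrt_of_sq_le (key p hp)
  have hRS' : R ^ 2 ≤ S := (Real.le_sqrt hR hS0).1 hRS
  nlinarith [mul_lt_mul_of_pos_left htD ht0]

/-- Lemma 2 of the paper: let `o'` be the MEB center of a finite nonempty set `P'`
with radius `r' = Rad(P')`, where `r' ≥ (1 - ε²)·R_P`.  If a ball `closedBall oTil r`
with `r ≤ (1 + ε'²)·R_P` covers `P'`, then `‖oTil - o'‖ < (√2·ε + √3·ε')·R_P`. -/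
theorem approx_center_close {d : ℕ} (hd : 1 ≤ d)
    (ε ε' R_P : ℝ) (hε0 : 0 < ε) (hε1 : ε < 1) (hε'0 : 0 < ε') (hε'1 : ε' < 1)
    (hRP : 0 < R_P)
    (P' : Finset (EuclideanSpace ℝ (Fin d))) (hP' : P'.Nonempty)
    (o' : EuclideanSpace ℝ (Fin d)) (r' : ℝ)
    (ho'cover : (P' : Set (EuclideanSpace ℝ (Fin d))) ⊆ closedBall o' r')
    (ho'min : ∀ (c : EuclideanSpace ℝ (Fin d)) (ρ : ℝ),
      (P' : Set (EuclideanSpace ℝ (Fin d))) ⊆ closedBall c ρ → r' ≤ ρ)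
    (hr' : (1 - ε ^ 2) * R_P ≤ r')
    (oTil : EuclideanSpace ℝ (Fin d)) (r : ℝ) (hr0 : 0 ≤ r)
    (hcover : (P' : Set (EuclideanSpace ℝ (Fin d))) ⊆ closedBall oTil r)
    (hr : r ≤ (1 + ε' ^ 2) * R_P) :
    ‖oTil - o'‖ < (Real.sqrt 2 * ε + Real.sqrt 3 * ε') * R_P := by
  have hD := norm_sub_sq_le_of_minimal_closedBall hP' ho'cover ho'min hcover
  have hε2 : ε ^ 2 < 1 := by nlinarith
  have hε'2 : ε' ^ 2 < 1 := by nlinarith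
  have hr_sq : r ^ 2 ≤ ((1 + ε' ^ 2) * R_P) ^ 2 := by gcongr
  have hr'_sq : ((1 - ε ^ 2) * R_P) ^ 2 ≤ r' ^ 2 :=
    pow_le_pow_left₀ (mul_nonneg (by linarith) hRP.le) hr' 2
  have hcoef : (1 + ε' ^ 2) ^ 2 - (1 - ε ^ 2) ^ 2 < (√2 * ε + √3 * ε') ^ 2 := by
    have hcross : 0 ≤ √2 * ε * (√3 * ε') := by positivity
    have h₂ : √2 ^ 2 = (2 : ℝ) := Real.sq_sqrt (by norm_num)
    have h₃ : √3 ^ 2 = (3 : ℝ) := Real.sq_sqrt (by norm_num)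
    have hexp : (√2 * ε + √3 * ε') ^ 2
        = 2 * ε ^ 2 + 3 * ε' ^ 2 + 2 * (√2 * ε * (√3 * ε')) := by
      linear_combination ε ^ 2 * h₂ + ε' ^ 2 * h₃
    nlinarith [pow_pos hε0 4, mul_pos (pow_pos hε'0 2) (sub_pos.2 hε'2)]
  refine lt_of_pow_lt_pow_left₀ 2 (by positivity) ?_
  have := mul_lt_mul_of_pos_right hcoef (pow_pos hRP 2)
  calc ‖oTil - o'‖ ^ 2 ≤ ((1 + ε' ^ 2) ^ 2 - (1 - ε ^ 2) ^ 2) * R_P ^ 2 := by linarith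
    _ < (√2 * ε + √3 * ε') ^ 2 * R_P ^ 2 := this
    _ = _ := (mul_pow _ _ _).symm
end

section
/- Assume ε, ε′, β₀ ∈ (0,1) and β ∈ (β₀, 1). Let P ⊆ E be a finite nonempty (ε², β)-stable set with n = |P|, and let o be an MEB center of P with radius Rad(P). Let õ ∈ E and let r be a real number with 0 ≤ r ≤ (1+ε′²)·Rad(P). If the ball closedBall(õ, r) contains at least (1−β₀)·n points of P, then ‖õ − o‖ < (2√2·ε + √3·ε′)·Rad(P). -/
open Metric

/-- The minimum enclosing ball (MEB) radius of a point set `P`: the infimum of all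
`r ≥ 0` such that `P` is contained in some closed ball of radius `r`. -/
noncomputable def MEBRadius {d : ℕ} (P : Set (EuclideanSpace ℝ (Fin d))) : ℝ :=
  sInf {r : ℝ | 0 ≤ r ∧ ∃ c : EuclideanSpace ℝ (Fin d), P ⊆ closedBall c r}

/-- Condition (1) of Definition 3 of the paper: a finite set `P` is `(α, β)`-stable
if, for every `Q ⊆ P` with `|Q| < β·|P|`, every closed ball containing `P \ Q`
has radius greater than `(1 - α)·Rad(P)`. -/
def StableMEB {d : ℕ} (P : Finset (EuclideanSpace ℝ (Fin d))) (α β : ℝ) : Prop :=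
  ∀ Q : Finset (EuclideanSpace ℝ (Fin d)), Q ⊆ P → (Q.card : ℝ) < β * P.card →
    ∀ (c : EuclideanSpace ℝ (Fin d)) (r : ℝ),
      ((P : Set (EuclideanSpace ℝ (Fin d))) \ (Q : Set (EuclideanSpace ℝ (Fin d))))
        ⊆ closedBall c r →
      (1 - α) * MEBRadius (P : Set (EuclideanSpace ℝ (Fin d))) < r

/-- Stewart's identity: the squared distance from a point to a point of a line. -/
theorem norm_sub_lineMap_sq {V : Type*} [NormedAddCommGroup V] [InnerProductSpace ℝ V]
    (x o p : V) (t : ℝ) :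
    ‖x - AffineMap.lineMap o p t‖ ^ 2 =
      (1 - t) * ‖x - o‖ ^ 2 + t * ‖x - p‖ ^ 2 - t * (1 - t) * ‖p - o‖ ^ 2 := by
  have hx : x - AffineMap.lineMap o p t = (1 - t) • (x - o) + t • (x - p) := by
    rw [AffineMap.lineMap_apply_module]
    module
  have hp : p - o = (x - o) - (x - p) := by abel
  rw [hx, hp, norm_add_sq_real, norm_sub_sq_real (x - o) (x - p), norm_smul, norm_smul,
    real_inner_smul_left, real_inner_smul_right, mul_pow, mul_pow, Real.norm_eq_abs,
    Real.norm_eq_abs, sq_abs, sq_abs]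
  ring

/-- If the centers of two balls are far apart, their intersection lies in a smaller ball. -/
theorem exists_inter_closedBall_subset {V : Type*} [NormedAddCommGroup V]
    [InnerProductSpace ℝ V] {o p : V} {R r a b ρ : ℝ} (ha : 0 < a) (hb : 0 ≤ b)
    (hr : r ^ 2 ≤ (1 + b ^ 2) * R ^ 2) (hR : 0 ≤ R) (hρ0 : 0 ≤ ρ)
    (hρ : (1 - a ^ 2 / 4) * R ^ 2 ≤ ρ ^ 2) (hD : (a + b) * R ≤ ‖p - o‖) :
    ∃ c : V, closedBall o R ∩ closedBall p r ⊆ closedBall c ρ := by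
  have hs : 0 < a + b := by positivity
  obtain ⟨t, ht⟩ : ∃ t : ℝ, t = a / (2 * (a + b)) := ⟨_, rfl⟩
  have hts : t * (a + b) = a / 2 := by rw [ht]; field_simp
  have ht0 : 0 ≤ t := by rw [ht]; positivity
  have ht1 : 0 ≤ 1 - t := by
    rw [ht, sub_nonneg, div_le_one (by positivity)]
    linarith
  have htb : t * b ≤ a / 2 := by nlinarith [mul_nonneg ht0 ha.le]
  refine ⟨AffineMap.lineMap o p t, fun x ⟨hxo, hxp⟩ ↦ ?_⟩
  rw [mem_closedBall, dist_eq_norm] at hxo hxp ⊢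
  refine le_of_sq_le_sq ?_ hρ0
  have hxo2 : (1 - t) * ‖x - o‖ ^ 2 ≤ (1 - t) * R ^ 2 := by gcongr
  have hxp2 : t * ‖x - p‖ ^ 2 ≤ t * ((1 + b ^ 2) * R ^ 2) :=
    mul_le_mul_of_nonneg_left ((pow_le_pow_left₀ (norm_nonneg _) hxp 2).trans hr) ht0
  have hD2 : t * (1 - t) * ((a + b) * R) ^ 2 ≤ t * (1 - t) * ‖p - o‖ ^ 2 := by gcongr
  have hcoef : t * b ^ 2 - t * (1 - t) * (a + b) ^ 2 ≤ -(a ^ 2 / 4) := by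
    have h : t * (1 - t) * (a + b) ^ 2 = a / 2 * (a + b - a / 2) := by
      rw [← hts]; ring
    nlinarith [mul_le_mul_of_nonneg_right htb hb]
  rw [norm_sub_lineMap_sq]
  nlinarith [mul_le_mul_of_nonneg_right hcoef (sq_nonneg R)]

/-- Theorem 2 of the paper (the implication of the stability property): if `P` is an
`(ε², β)`-stable instance with `β > β₀`, `o` is the center of `MEB(P)`, and a ball
`closedBall oTil r` with `r ≤ (1 + ε'²)·Rad(P)` covers at least `(1 - β₀)·n` points of
`P`, then `‖oTil - o‖ < (2√2·ε + √3·ε')·Rad(P)`. -/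
theorem stability_implication {d : ℕ} (hd : 1 ≤ d)
    (ε ε' β₀ β : ℝ)
    (hε0 : 0 < ε) (hε1 : ε < 1) (hε'0 : 0 < ε') (hε'1 : ε' < 1)
    (hβ₀0 : 0 < β₀) (hβ₀1 : β₀ < 1) (hβ : β₀ < β) (hβ1 : β < 1)
    (P : Finset (EuclideanSpace ℝ (Fin d))) (hP : P.Nonempty)
    (hstable : StableMEB P (ε ^ 2) β)
    (o : EuclideanSpace ℝ (Fin d))
    (hocover : (P : Set (EuclideanSpace ℝ (Fin d)))
      ⊆ closedBall o (MEBRadius (P : Set (EuclideanSpace ℝ (Fin d)))))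
    (homin : ∀ (c : EuclideanSpace ℝ (Fin d)) (ρ : ℝ),
      (P : Set (EuclideanSpace ℝ (Fin d))) ⊆ closedBall c ρ →
        MEBRadius (P : Set (EuclideanSpace ℝ (Fin d))) ≤ ρ)
    (oTil : EuclideanSpace ℝ (Fin d)) (r : ℝ) (hr0 : 0 ≤ r)
    (hr : r ≤ (1 + ε' ^ 2) * MEBRadius (P : Set (EuclideanSpace ℝ (Fin d))))
    (hcov : (1 - β₀) * (P.card : ℝ) ≤
      ((closedBall oTil r ∩ (P : Set (EuclideanSpace ℝ (Fin d)))).ncard : ℝ)) :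
    ‖oTil - o‖ < (2 * Real.sqrt 2 * ε + Real.sqrt 3 * ε') *
      MEBRadius (P : Set (EuclideanSpace ℝ (Fin d))) := by
  classical
  set R := MEBRadius (P : Set (EuclideanSpace ℝ (Fin d)))
  set S := P.filter (· ∈ closedBall oTil r)
  have hS : closedBall oTil r ∩ (P : Set (EuclideanSpace ℝ (Fin d))) = S := by
    ext x
    simp [S, and_comm]
  rw [hS, Set.ncard_coe_finset] at hcov
  have hSP : S ⊆ P := Finset.filter_subset _ _
  have hcard : ((P \ S).card : ℝ) < β * P.card := by
    have hn : (0 : ℝ) < P.card := by exact_mod_cast hP.card_pos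
    rw [Finset.cast_card_sdiff hSP]
    nlinarith [mul_lt_mul_of_pos_right hβ hn]
  have hstab (c : EuclideanSpace ℝ (Fin d)) (ρ : ℝ)
      (h : closedBall o R ∩ closedBall oTil r ⊆ closedBall c ρ) : (1 - ε ^ 2) * R < ρ := by
    refine hstable _ Finset.sdiff_subset hcard c ρ fun x hx ↦ h ?_
    have hxS : x ∈ S := by
      by_contra hxS
      exact hx.2 (by simpa [hxS] using hx.1)
    exact ⟨hocover hx.1, (Finset.mem_filter.mp hxS).2⟩
  have hR : 0 < R := by
    have := hstab o R Set.inter_subset_left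
    have hε : 0 < ε ^ 2 := by positivity
    nlinarith
  by_contra! hD
  have hb : (√3 * ε') ^ 2 = 3 * ε' ^ 2 := by rw [mul_pow, Real.sq_sqrt (by norm_num)]
  have ha : (2 * √2 * ε) ^ 2 = 8 * ε ^ 2 := by
    rw [mul_pow, mul_pow, Real.sq_sqrt (by norm_num)]
    ring
  have hr2 : r ^ 2 ≤ (1 + (√3 * ε') ^ 2) * R ^ 2 := by
    have hε' : ε' ^ 2 ≤ 1 := pow_le_one₀ hε'0.le hε'1.le
    calc r ^ 2 ≤ ((1 + ε' ^ 2) * R) ^ 2 := pow_le_pow_left₀ hr0 hr 2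
      _ = (1 + ε' ^ 2) ^ 2 * R ^ 2 := mul_pow _ _ _
      _ ≤ (1 + (√3 * ε') ^ 2) * R ^ 2 := by
        gcongr
        nlinarith [sq_nonneg ε']
  have hε2 : 0 ≤ 1 - ε ^ 2 := sub_nonneg.mpr (pow_le_one₀ hε0.le hε1.le)
  obtain ⟨c, hc⟩ := exists_inter_closedBall_subset (ρ := (1 - ε ^ 2) * R)
    (by positivity) (by positivity) hr2 hR.le (by positivity)
    (by rw [ha, mul_pow]; gcongr; nlinarith [sq_nonneg (ε ^ 2)]) hD
  exact (hstab c _ hc).false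
end

section
/- Let P ⊆ E be finite and nonempty, and let c be an MEB center of P with radius R = Rad(P). Then for every vector v ∈ E there exists a point p ∈ P with ‖p − c‖ = R and ⟪p − c, v⟫ ≥ 0. Equivalently, every closed half-space containing c contains a point of P at distance exactly R from c. -/
open Metric
open scoped RealInnerProductSpace Topology

/-- Moving a vector of norm at most `R` slightly in a direction `v` brings it into the open ball of
radius `R`, as long as `v` points inwards when the vector lies on the sphere. -/
theorem eventually_norm_add_smul_lt {E : Type*} [NormedAddCommGroup E] [InnerProductSpace ℝ E]
    {x v : E} {R : ℝ} (hx : ‖x‖ ≤ R) (hv : ‖x‖ = R → ⟪x, v⟫ < 0) :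
    ∀ᶠ t : ℝ in 𝓝[>] 0, ‖x + t • v‖ < R := by
  rcases hx.lt_or_eq with h | rfl
  · have hcont : Continuous fun t : ℝ => ‖x + t • v‖ := by fun_prop
    exact (hcont.continuousAt.eventually_lt_const (by simpa using h)).filter_mono
      nhdsWithin_le_nhds
  · have hcont : Continuous fun t : ℝ => 2 * ⟪x, v⟫ + t * ‖v‖ ^ 2 := by fun_prop
    have hneg : ∀ᶠ t : ℝ in 𝓝[>] 0, 2 * ⟪x, v⟫ + t * ‖v‖ ^ 2 < 0 :=
      (hcont.continuousAt.eventually_lt_const (by linarith [hv rfl])).filter_mono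
        nhdsWithin_le_nhds
    filter_upwards [hneg, self_mem_nhdsWithin] with t ht htpos
    refine lt_of_pow_lt_pow_left₀ 2 (norm_nonneg x) ?_
    rw [norm_add_sq_real, real_inner_smul_right, norm_smul, mul_pow, Real.norm_eq_abs, sq_abs]
    nlinarith [mul_neg_of_pos_of_neg (Set.mem_Ioi.mp htpos) ht]

/-- Lemma 9 of the paper (Lemma 2.2 of Bădoiu–Har-Peled–Indyk): if `c` is the MEB
center of a finite nonempty set `P` with radius `R = Rad(P)`, then every closed
half-space containing `c` contains a point of `P` at distance exactly `R` from `c`;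
equivalently, for every vector `v` there is `p ∈ P` with `‖p - c‖ = R` and
`⟪p - c, v⟫ ≥ 0`. -/
theorem halfspace_contains_support_point {d : ℕ} (hd : 1 ≤ d)
    (P : Finset (EuclideanSpace ℝ (Fin d))) (hP : P.Nonempty)
    (c : EuclideanSpace ℝ (Fin d)) (R : ℝ)
    (hcover : (P : Set (EuclideanSpace ℝ (Fin d))) ⊆ closedBall c R)
    (hmin : ∀ (c' : EuclideanSpace ℝ (Fin d)) (ρ : ℝ),
      (P : Set (EuclideanSpace ℝ (Fin d))) ⊆ closedBall c' ρ → R ≤ ρ) :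
    ∀ v : EuclideanSpace ℝ (Fin d), ∃ p ∈ P, ‖p - c‖ = R ∧ 0 ≤ ⟪p - c, v⟫ := by
  intro v
  by_contra! hcon
  have hev : ∀ᶠ t : ℝ in 𝓝[>] 0, ∀ p ∈ P, ‖(p - c) + t • v‖ < R :=
    (Finset.eventually_all P).2 fun p hp =>
      eventually_norm_add_smul_lt (mem_closedBall_iff_norm.1 (hcover hp)) (hcon p hp)
  obtain ⟨t, ht⟩ := hev.exists
  have hle : R ≤ P.sup' hP fun p => ‖(p - c) + t • v‖ := by
    refine hmin (c - t • v) _ fun p hp => ?_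
    rw [mem_closedBall_iff_norm, sub_sub_eq_add_sub, add_sub_right_comm]
    exact Finset.le_sup' (fun p => ‖(p - c) + t • v‖) hp
  exact hle.not_gt ((Finset.sup'_lt_iff hP).2 ht)
end

section
/- Let ε, β₀ ∈ (0,1) and β ∈ (β₀, 1). Let P ⊆ E be a finite nonempty (ε², β)-stable set with n = |P|. Let S ⊆ P be nonempty, and let c ∈ E and r ≥ 0 satisfy S ⊆ closedBall(c, r) and r ≤ (1+ε²)·Rad(S) (i.e., B(c,r) is a (1+ε²)-radius approximate MEB of S). If |closedBall(c, r) ∩ P| ≥ (1−β₀)·n, then, with x = (2√2+√3)·ε: (i) P ⊆ closedBall(c, ((1+x)/(1−ε²))·r), and (ii) ((1+x)/(1−ε²))·r ≤ λ·Rad(P), where λ = (1+x)(1+ε²)/(1−ε²). In particular the expanded ball is a λ-radius approximate MEB of P. -/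
open Metric

theorem bddBelow_enclosing_radii {d : ℕ} (P : Set (EuclideanSpace ℝ (Fin d))) :
    BddBelow {r : ℝ | 0 ≤ r ∧ ∃ c : EuclideanSpace ℝ (Fin d), P ⊆ closedBall c r} :=
  ⟨0, fun _ h => h.1⟩

theorem nonempty_enclosing_radii {d : ℕ} (P : Finset (EuclideanSpace ℝ (Fin d))) :
    {r : ℝ | 0 ≤ r ∧ ∃ c : EuclideanSpace ℝ (Fin d),
      (P : Set (EuclideanSpace ℝ (Fin d))) ⊆ closedBall c r}.Nonempty := by
  obtain ⟨r, hr⟩ := P.finite_toSet.isBounded.subset_closedBall 0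
  exact ⟨max r 0, le_max_right _ _, 0, hr.trans (closedBall_subset_closedBall (le_max_left _ _))⟩

theorem MEBRadius_mono {d : ℕ} {S : Set (EuclideanSpace ℝ (Fin d))}
    {P : Finset (EuclideanSpace ℝ (Fin d))} (h : S ⊆ P) :
    MEBRadius S ≤ MEBRadius (P : Set (EuclideanSpace ℝ (Fin d))) :=
  csInf_le_csInf (bddBelow_enclosing_radii S) (nonempty_enclosing_radii P)
    fun _ ⟨hr, c, hc⟩ => ⟨hr, c, h.trans hc⟩

theorem exists_subset_closedBall_of_MEBRadius_lt {d : ℕ}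
    (P : Finset (EuclideanSpace ℝ (Fin d))) {r : ℝ}
    (h : MEBRadius (P : Set (EuclideanSpace ℝ (Fin d))) < r) :
    ∃ o : EuclideanSpace ℝ (Fin d),
      (P : Set (EuclideanSpace ℝ (Fin d))) ⊆ closedBall o r := by
  obtain ⟨t, ⟨-, o, ho⟩, htr⟩ := exists_lt_of_csInf_lt (nonempty_enclosing_radii P) h
  exact ⟨o, ho.trans (closedBall_subset_closedBall htr.le)⟩

/-- The intersection of two closed balls lies in a ball about the midpoint of their centers. -/
theorem closedBall_inter_closedBall_subset_midpoint {E : Type*} [NormedAddCommGroup E]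
    [InnerProductSpace ℝ E] (c o : E) (r s : ℝ) :
    closedBall c r ∩ closedBall o s ⊆
      closedBall (midpoint ℝ c o) (√((r ^ 2 + s ^ 2) / 2 - dist c o ^ 2 / 4)) := by
  rintro p ⟨hc, ho⟩
  rw [mem_closedBall] at hc ho ⊢
  apply Real.le_sqrt_of_sq_le
  have hm : dist p (midpoint ℝ c o) = ‖(p - c) + (p - o)‖ / 2 := by
    have : p - midpoint ℝ c o = (2⁻¹ : ℝ) • ((p - c) + (p - o)) := by
      rw [midpoint_eq_smul_add, invOf_eq_inv]
      module
    rw [dist_eq_norm, this, norm_smul, Real.norm_of_nonneg (by norm_num)]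
    ring
  have hpar := parallelogram_law_with_norm ℝ (p - c) (p - o)
  rw [sub_sub_sub_cancel_left, ← dist_eq_norm o c, dist_comm o c, ← dist_eq_norm p c,
    ← dist_eq_norm p o] at hpar
  have h1 : dist p c ^ 2 ≤ r ^ 2 := pow_le_pow_left₀ dist_nonneg hc 2
  have h2 : dist p o ^ 2 ≤ s ^ 2 := pow_le_pow_left₀ dist_nonneg ho 2
  rw [hm]
  nlinarith

/-- The part of a stable set covered by a ball is hard to enclose, provided the ball
misses few enough points. -/
theorem StableMEB.lt_of_inter_subset {d : ℕ} {P : Finset (EuclideanSpace ℝ (Fin d))}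
    {α β β₀ : ℝ} (hP : P.Nonempty) (h : StableMEB P α β) (hβ : β₀ < β)
    {A : Set (EuclideanSpace ℝ (Fin d))}
    (hA : (1 - β₀) * (P.card : ℝ) ≤
      ((A ∩ (P : Set (EuclideanSpace ℝ (Fin d)))).ncard : ℝ))
    {c : EuclideanSpace ℝ (Fin d)} {r : ℝ}
    (hr : A ∩ (P : Set (EuclideanSpace ℝ (Fin d))) ⊆ closedBall c r) :
    (1 - α) * MEBRadius (P : Set (EuclideanSpace ℝ (Fin d))) < r := by
  classical
  have hcard : (0 : ℝ) < P.card := by exact_mod_cast hP.card_pos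
  refine h (P.filter (· ∉ A)) (Finset.filter_subset _ _) ?_ c r fun p hp => hr ?_
  · have hfilter : A ∩ (P : Set (EuclideanSpace ℝ (Fin d))) = ↑(P.filter (· ∈ A)) := by
      ext p
      simp [and_comm]
    rw [hfilter, Set.ncard_coe_finset] at hA
    have hsum : ((P.filter (· ∈ A)).card : ℝ) + (P.filter (· ∉ A)).card = P.card := by
      exact_mod_cast P.card_filter_add_card_filter_not (· ∈ A)
    nlinarith
  · simp only [Finset.coe_filter, Set.mem_sdiff, Finset.mem_coe, Set.mem_ofPred_eq, not_and,
      not_not] at hp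
    exact ⟨hp.2 hp.1, hp.1⟩

/-- The deterministic core of Theorem 3 of the paper (quality analysis of
Algorithm 1): if `P` is `(ε², β)`-stable with `β > β₀`, `closedBall c r` is a
`(1 + ε²)`-radius approximate MEB of a nonempty subset `S ⊆ P`, and
`closedBall c r` contains at least `(1 - β₀)·n` points of `P`, then with
`x = (2√2 + √3)·ε` the expanded ball `closedBall c ((1+x)/(1-ε²)·r)` covers `P`
and its radius is at most `λ·Rad(P)` where `λ = (1+x)(1+ε²)/(1-ε²)`. -/
theorem expanded_ball_is_lambda_approx {d : ℕ} (hd : 1 ≤ d)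
    (ε β₀ β : ℝ)
    (hε0 : 0 < ε) (hε1 : ε < 1)
    (hβ₀0 : 0 < β₀) (hβ₀1 : β₀ < 1) (hβ : β₀ < β) (hβ1 : β < 1)
    (P : Finset (EuclideanSpace ℝ (Fin d))) (hP : P.Nonempty)
    (hstable : StableMEB P (ε ^ 2) β)
    (S : Finset (EuclideanSpace ℝ (Fin d))) (hSP : S ⊆ P) (hS : S.Nonempty)
    (c : EuclideanSpace ℝ (Fin d)) (r : ℝ) (hr0 : 0 ≤ r)
    (hScover : (S : Set (EuclideanSpace ℝ (Fin d))) ⊆ closedBall c r)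
    (hrapprox : r ≤ (1 + ε ^ 2) * MEBRadius (S : Set (EuclideanSpace ℝ (Fin d))))
    (hcov : (1 - β₀) * (P.card : ℝ) ≤
      ((closedBall c r ∩ (P : Set (EuclideanSpace ℝ (Fin d)))).ncard : ℝ)) :
    (P : Set (EuclideanSpace ℝ (Fin d))) ⊆
        closedBall c ((1 + (2 * Real.sqrt 2 + Real.sqrt 3) * ε) / (1 - ε ^ 2) * r) ∧
      (1 + (2 * Real.sqrt 2 + Real.sqrt 3) * ε) / (1 - ε ^ 2) * r ≤
        (1 + (2 * Real.sqrt 2 + Real.sqrt 3) * ε) * (1 + ε ^ 2) / (1 - ε ^ 2) *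
          MEBRadius (P : Set (EuclideanSpace ℝ (Fin d))) := by
  have hε2 : 0 < 1 - ε ^ 2 := by nlinarith
  have hSP' := MEBRadius_mono (Finset.coe_subset.2 hSP)
  have hr_lower := hstable.lt_of_inter_subset hP hβ hcov Set.inter_subset_left
  set R := MEBRadius (P : Set (EuclideanSpace ℝ (Fin d))) with hR
  have hr_upper : r ≤ (1 + ε ^ 2) * R :=
    hrapprox.trans (mul_le_mul_of_nonneg_left hSP' (by positivity))
  have hRpos : 0 < R := by
    have : 0 < ε ^ 2 := by positivity
    by_contra! hR0
    nlinarith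
  have h2 : (1.4 : ℝ) ≤ √2 := Real.le_sqrt_of_sq_le (by norm_num)
  have h3 : (1.7 : ℝ) ≤ √3 := Real.le_sqrt_of_sq_le (by norm_num)
  have hx : 4.5 * ε ≤ (2 * √2 + √3) * ε :=
    mul_le_mul_of_nonneg_right (by linarith) hε0.le
  constructor
  · obtain ⟨o, ho⟩ := exists_subset_closedBall_of_MEBRadius_lt P
      (r := (1 + ε ^ 2 / 4) * R) (by rw [← hR]; nlinarith [mul_pos (pow_pos hε0 2) hRpos])
    have hmid := hstable.lt_of_inter_subset hP hβ hcov
      ((Set.inter_subset_inter_right _ ho).trans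
        (closedBall_inter_closedBall_subset_midpoint c o _ _))
    rw [← hR, Real.lt_sqrt (by positivity)] at hmid
    have hr_sq : r ^ 2 ≤ ((1 + ε ^ 2) * R) ^ 2 := pow_le_pow_left₀ hr0 hr_upper 2
    have hdist : dist o c ≤ 4 * ε * R := by
      rw [dist_comm]
      refine (pow_le_pow_iff_left₀ dist_nonneg (by positivity) two_ne_zero).1 ?_
      have hε4 : ε ^ 4 * R ^ 2 ≤ ε ^ 2 * R ^ 2 :=
        mul_le_mul_of_nonneg_right (pow_le_pow_of_le_one hε0.le hε1.le (by norm_num))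
          (by positivity)
      have : 0 ≤ ε ^ 4 * R ^ 2 := by positivity
      nlinarith
    intro p hp
    calc dist p c ≤ dist p o + dist o c := dist_triangle _ _ _
      _ ≤ (1 + ε ^ 2 / 4) * R + 4 * ε * R := add_le_add (ho hp) hdist
      _ = (1 + (ε ^ 2 / 4 + 4 * ε)) * R := by ring
      _ ≤ (1 + (2 * √2 + √3) * ε) * R := by
        gcongr
        nlinarith
      _ ≤ (1 + (2 * √2 + √3) * ε) * (r / (1 - ε ^ 2)) := by
        gcongr
        rw [le_div_iff₀ hε2]
        linarith
      _ = (1 + (2 * √2 + √3) * ε) / (1 - ε ^ 2) * r := by ring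
  · calc (1 + (2 * √2 + √3) * ε) / (1 - ε ^ 2) * r
        ≤ (1 + (2 * √2 + √3) * ε) / (1 - ε ^ 2) * ((1 + ε ^ 2) * R) := by gcongr
      _ = (1 + (2 * √2 + √3) * ε) * (1 + ε ^ 2) / (1 - ε ^ 2) * R := by ring
end

section
/- Let ε, β₀ ∈ (0,1) and β ∈ (β₀, 1). Let P ⊆ E be a finite nonempty (ε², β)-stable set with n = |P|, and let p₁, p₂ ∈ P be such that |{q ∈ P : ‖q − p₁‖ > ‖p₂ − p₁‖}| < β₀·n (i.e., p₂ is among the β₀·n farthest points of P from p₁). Then (1/2)·‖p₁ − p₂‖ ≤ Rad(P) ≤ (1/(1−ε²))·‖p₁ − p₂‖. -/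
open Metric

/-- Any two points of a finite set are at distance at most twice its MEB radius. -/
theorem dist_le_two_mul_MEBRadius {d : ℕ} (P : Finset (EuclideanSpace ℝ (Fin d)))
    {x y : EuclideanSpace ℝ (Fin d)} (hx : x ∈ P) (hy : y ∈ P) :
    dist x y ≤ 2 * MEBRadius (P : Set (EuclideanSpace ℝ (Fin d))) := by
  obtain ⟨R, hR⟩ := P.finite_toSet.isBounded.subset_closedBall x
  have hhalf : dist x y / 2 ≤ MEBRadius (P : Set (EuclideanSpace ℝ (Fin d))) := by
    refine le_csInf ⟨R, dist_nonneg.trans (mem_closedBall.1 (hR hx)), x, hR⟩ ?_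
    rintro r ⟨-, c, hc⟩
    have hxc := mem_closedBall.1 (hc hx)
    have hyc := mem_closedBall.1 (hc hy)
    linarith [dist_triangle_right x y c]
  linarith

/-- The deterministic core of Lemma 4 of the paper: if `P` is `(ε², β)`-stable with
`β > β₀` and `p₂` is among the `β₀·n` farthest points of `P` from `p₁` (fewer than
`β₀·n` points of `P` are strictly farther from `p₁` than `p₂`), then
`Rad(P) ∈ [‖p₁ - p₂‖/2, ‖p₁ - p₂‖/(1 - ε²)]`. -/
theorem radius_estimate {d : ℕ} (hd : 1 ≤ d)
    (ε β₀ β : ℝ)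
    (hε0 : 0 < ε) (hε1 : ε < 1)
    (hβ₀0 : 0 < β₀) (hβ₀1 : β₀ < 1) (hβ : β₀ < β) (hβ1 : β < 1)
    (P : Finset (EuclideanSpace ℝ (Fin d))) (hP : P.Nonempty)
    (hstable : StableMEB P (ε ^ 2) β)
    (p₁ p₂ : EuclideanSpace ℝ (Fin d)) (hp₁ : p₁ ∈ P) (hp₂ : p₂ ∈ P)
    (hfar : (({q : EuclideanSpace ℝ (Fin d) |
        q ∈ (P : Set (EuclideanSpace ℝ (Fin d))) ∧ ‖p₂ - p₁‖ < ‖q - p₁‖}.ncard : ℝ))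
      < β₀ * (P.card : ℝ)) :
    (1 / 2) * ‖p₁ - p₂‖ ≤ MEBRadius (P : Set (EuclideanSpace ℝ (Fin d))) ∧
      MEBRadius (P : Set (EuclideanSpace ℝ (Fin d))) ≤ (1 / (1 - ε ^ 2)) * ‖p₁ - p₂‖ := by
  constructor
  · have hdist := dist_le_two_mul_MEBRadius P hp₁ hp₂
    rw [dist_eq_norm] at hdist
    linarith
  · have hfilter : {q : EuclideanSpace ℝ (Fin d) |
        q ∈ (P : Set (EuclideanSpace ℝ (Fin d))) ∧ ‖p₂ - p₁‖ < ‖q - p₁‖}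
        = (P.filter fun q => ‖p₂ - p₁‖ < ‖q - p₁‖ : Finset (EuclideanSpace ℝ (Fin d))) := by
      ext q
      simp
    rw [hfilter, Set.ncard_coe_finset] at hfar
    have hcard : (0 : ℝ) < P.card := by exact_mod_cast hP.card_pos
    have hlt := hstable (P.filter fun q => ‖p₂ - p₁‖ < ‖q - p₁‖) (Finset.filter_subset _ _)
      (hfar.trans (mul_lt_mul_of_pos_right hβ hcard)) p₁ ‖p₂ - p₁‖ (by
        rintro q ⟨hqP, hq⟩
        rw [mem_closedBall, dist_eq_norm]
        by_contra! h
        exact hq (Finset.mem_coe.2 (Finset.mem_filter.2 ⟨hqP, h⟩)))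
    have hε : 0 < 1 - ε ^ 2 := by nlinarith
    rw [norm_sub_rev p₁ p₂, one_div_mul_eq_div, le_div_iff₀ hε]
    linarith
end

section
/- Let P be a finite set of points in E, o ∈ E, P_opt ⊆ P, and δ, γ > 0. Let A ⊆ P with n′ = |A|, and let l, l′ ∈ ℝ. Define Q = {p ∈ P : ‖p − o‖ > l} and Q′ = {p ∈ A : ‖p − o‖ > l′}. Suppose |Q′| = (3/2)(δ+γ)·n′, |A ∩ Q| < (3/2)(δ+γ)·n′, and |A ∩ (P_opt ∩ Q)| > (1/2)·δ·n′. Then Q′ ∩ (P_opt ∩ Q) = A ∩ (P_opt ∩ Q), and consequently |Q′ ∩ (P_opt ∩ Q)| / |Q′| ≥ δ/(3(δ+γ)). -/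
open Metric

/-- The deterministic core of Lemma 7 of the paper (the Uniform-Adaptive Sampling
lemma): `Q` is the set of points of `P` farther than `l` from `o`, `A ⊆ P` a sample
of size `n'`, and `Q'` the set of points of `A` farther than `l'` from `o`.  If
`|Q'| = (3/2)(δ+γ)·n'`, `|A ∩ Q| < (3/2)(δ+γ)·n'`, and
`|A ∩ (P_opt ∩ Q)| > δ·n'/2`, then `Q' ∩ (P_opt ∩ Q) = A ∩ (P_opt ∩ Q)` and
`|Q' ∩ (P_opt ∩ Q)| / |Q'| ≥ δ/(3(δ+γ))`. -/
theorem uniform_adaptive_sampling_core {d : ℕ} (hd : 1 ≤ d)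
    (P : Set (EuclideanSpace ℝ (Fin d))) (hPfin : P.Finite)
    (o : EuclideanSpace ℝ (Fin d))
    (Popt : Set (EuclideanSpace ℝ (Fin d))) (hPopt : Popt ⊆ P)
    (δ γ : ℝ) (hδ : 0 < δ) (hγ : 0 < γ)
    (A : Set (EuclideanSpace ℝ (Fin d))) (hA : A ⊆ P)
    (n' : ℕ) (hn' : A.ncard = n')
    (l l' : ℝ) (Q Q' : Set (EuclideanSpace ℝ (Fin d)))
    (hQ : Q = {p ∈ P | l < ‖p - o‖})
    (hQ' : Q' = {p ∈ A | l' < ‖p - o‖})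
    (hQ'card : (Q'.ncard : ℝ) = (3 / 2) * (δ + γ) * (n' : ℝ))
    (hAQ : ((A ∩ Q).ncard : ℝ) < (3 / 2) * (δ + γ) * (n' : ℝ))
    (hhit : (1 / 2) * δ * (n' : ℝ) < ((A ∩ (Popt ∩ Q)).ncard : ℝ)) :
    Q' ∩ (Popt ∩ Q) = A ∩ (Popt ∩ Q) ∧
      δ / (3 * (δ + γ)) ≤ ((Q' ∩ (Popt ∩ Q)).ncard : ℝ) / (Q'.ncard : ℝ) := by
  have hAfin : A.Finite := hPfin.subset hA
  have hll : l' < l := by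
    by_contra! h
    have hsub : Q' ⊆ A ∩ Q := by
      rw [hQ, hQ']
      exact fun p hp => ⟨hp.1, hA hp.1, h.trans_lt hp.2⟩
    have hle : (Q'.ncard : ℝ) ≤ (A ∩ Q).ncard :=
      mod_cast Set.ncard_le_ncard hsub (hAfin.inter_of_left Q)
    linarith
  have heq : Q' ∩ (Popt ∩ Q) = A ∩ (Popt ∩ Q) := by
    rw [hQ, hQ']
    ext p
    exact ⟨fun hp => ⟨hp.1.1, hp.2⟩, fun hp => ⟨⟨hp.1, hll.trans hp.2.2.2⟩, hp.2⟩⟩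
  refine ⟨heq, ?_⟩
  have hpos : 0 < 3 / 2 * (δ + γ) * (n' : ℝ) := (Nat.cast_nonneg _).trans_lt hAQ
  rw [heq, hQ'card, div_le_div_iff₀ (by positivity) hpos]
  have hmul := mul_le_mul_of_nonneg_right hhit.le (by positivity : 0 ≤ 3 * (δ + γ))
  linarith
end

section
/- Let P ⊆ E be finite with n = |P|, let o ∈ E, let γ ∈ (0,1) and 0 < δ < γ/3, and let B ⊆ P and k ∈ ℕ. Let l, l̃, l̃′ ∈ ℝ satisfy: |{p ∈ P : ‖p − o‖ > l}| = (δ+γ)·n (write Q for this set), |{p ∈ P : ‖p − o‖ > l̃′}| = ((γ+δ)²/(γ−δ))·n, |{p ∈ B : ‖p − o‖ > l̃}| = k, |{p ∈ B : ‖p − o‖ > l̃′}| > k, and |B ∩ Q| < k. Then l̃′ ≤ l̃ ≤ l, and |{p ∈ P : ‖p − o‖ > l̃}| ≤ ((γ+δ)²/(γ−δ))·n ≤ (γ+5δ)·n. -/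
open Metric

/-- The deterministic core of Lemma 8 of the paper (the Sandwich Lemma): `o` is a
candidate center, `l` is the threshold with exactly `(δ+γ)·n` points of `P` farther
than `l` from `o` (the set `Q`), `l̃'` is the threshold with exactly
`((γ+δ)²/(γ-δ))·n` points of `P` beyond it, and `l̃` is the threshold with exactly
`k` points of the sample `B` beyond it.  If more than `k` points of `B` are beyond
`l̃'` and `|B ∩ Q| < k`, then `l̃' ≤ l̃ ≤ l` and at most
`((γ+δ)²/(γ-δ))·n ≤ (γ+5δ)·n` points of `P` are beyond `l̃`. -/
theorem sandwich_lemma_core {d : ℕ} (hd : 1 ≤ d)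
    (P : Set (EuclideanSpace ℝ (Fin d))) (hPfin : P.Finite)
    (n : ℕ) (hn : P.ncard = n)
    (o : EuclideanSpace ℝ (Fin d))
    (γ δ : ℝ) (hγ0 : 0 < γ) (hγ1 : γ < 1) (hδ0 : 0 < δ) (hδγ : δ < γ / 3)
    (B : Set (EuclideanSpace ℝ (Fin d))) (hB : B ⊆ P) (k : ℕ)
    (l lTil lTil' : ℝ)
    (hl : (({p ∈ P | l < ‖p - o‖}).ncard : ℝ) = (δ + γ) * (n : ℝ))
    (hlTil' : (({p ∈ P | lTil' < ‖p - o‖}).ncard : ℝ) = (γ + δ) ^ 2 / (γ - δ) * (n : ℝ))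
    (hlTilB : ({p ∈ B | lTil < ‖p - o‖}).ncard = k)
    (hlTil'B : k < ({p ∈ B | lTil' < ‖p - o‖}).ncard)
    (hBQ : (B ∩ {p ∈ P | l < ‖p - o‖}).ncard < k) :
    lTil' ≤ lTil ∧ lTil ≤ l ∧
      (({p ∈ P | lTil < ‖p - o‖}).ncard : ℝ) ≤ (γ + δ) ^ 2 / (γ - δ) * (n : ℝ) ∧
      (γ + δ) ^ 2 / (γ - δ) * (n : ℝ) ≤ (γ + 5 * δ) * (n : ℝ) := by
  have hBfin : B.Finite := hPfin.subset hB
  have h_lower : lTil' ≤ lTil := by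
    by_contra! h
    have hle : ({p ∈ B | lTil' < ‖p - o‖}).ncard ≤ ({p ∈ B | lTil < ‖p - o‖}).ncard :=
      Set.ncard_le_ncard (fun p hp => ⟨hp.1, h.trans hp.2⟩) (hBfin.subset (Set.sep_subset _ _))
    omega
  have h_upper : lTil ≤ l := by
    by_contra! h
    have hle : ({p ∈ B | lTil < ‖p - o‖}).ncard ≤ (B ∩ {p ∈ P | l < ‖p - o‖}).ncard :=
      Set.ncard_le_ncard (fun p hp => ⟨hp.1, hB hp.1, h.trans hp.2⟩)
        (hBfin.subset Set.inter_subset_left)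
    omega
  refine ⟨h_lower, h_upper, ?_, ?_⟩
  · rw [← hlTil']
    refine Nat.cast_le.mpr (Set.ncard_le_ncard (fun p hp => ⟨hp.1, h_lower.trans_lt hp.2⟩)
      (hPfin.subset (Set.sep_subset _ _)))
  · refine mul_le_mul_of_nonneg_right ?_ n.cast_nonneg
    rw [div_le_iff₀ (by linarith)]
    nlinarith
end

section
/- Let P ⊆ E be finite and nonempty with n = |P|, let ε, δ ∈ (0,1), let R = Rad(P), and let r_half denote the infimum of all r ≥ 0 such that some closed ball of radius r contains at least (1−δ/2)·n points of P. Suppose õ ∈ E and r_õ, r_c > 0 satisfy P ⊆ closedBall(õ, r_õ), r_c ≤ (1+ε²/2)·r_half, and r_õ·(1−ε²/2) ≤ (1+ε)·r_c. Then r_half > (1−ε)·R; i.e., the stability parameter α̂ = 1 − r_half/R satisfies α̂ < ε. -/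
open Metric

/-- The smallest radius of a closed ball containing at least `m` points of `P`:
the infimum of all `r ≥ 0` such that some closed ball of radius `r` contains at
least `m` points of `P`. -/
noncomputable def PartialRadius {d : ℕ} (P : Finset (EuclideanSpace ℝ (Fin d)))
    (m : ℝ) : ℝ :=
  sInf {r : ℝ | 0 ≤ r ∧ ∃ c : EuclideanSpace ℝ (Fin d),
    m ≤ (((closedBall c r ∩ (P : Set (EuclideanSpace ℝ (Fin d)))).ncard : ℝ))}

/-- The radius of any enclosing ball bounds the MEB radius from above. -/
theorem MEBRadius_le_of_subset_closedBall {d : ℕ} {P : Set (EuclideanSpace ℝ (Fin d))}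
    {c : EuclideanSpace ℝ (Fin d)} {r : ℝ} (hr : 0 ≤ r) (hP : P ⊆ closedBall c r) :
    MEBRadius P ≤ r :=
  csInf_le ⟨0, fun _ hx => hx.1⟩ ⟨hr, c, hP⟩

/-- The first branch of Theorem 10 of the paper (inferring the stability degree
from the output of Algorithm 5): if `P ⊆ closedBall oTil r_o`,
`r_c ≤ (1+ε²/2)·r_half` and the ratio test `r_o·(1-ε²/2) ≤ (1+ε)·r_c` passes, then
`r_half > (1-ε)·Rad(P)`, i.e. the stability parameter `α̂ = 1 - r_half/Rad(P)`
satisfies `α̂ < ε`. -/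
theorem infer_stability {d : ℕ} (hd : 1 ≤ d)
    (ε δ : ℝ) (hε0 : 0 < ε) (hε1 : ε < 1) (hδ0 : 0 < δ) (hδ1 : δ < 1)
    (P : Finset (EuclideanSpace ℝ (Fin d))) (hP : P.Nonempty) (n : ℕ) (hn : P.card = n)
    (oTil : EuclideanSpace ℝ (Fin d)) (r_o r_c : ℝ) (hro0 : 0 < r_o) (hrc0 : 0 < r_c)
    (hocover : (P : Set (EuclideanSpace ℝ (Fin d))) ⊆ closedBall oTil r_o)
    (hrc : r_c ≤ (1 + ε ^ 2 / 2) * PartialRadius P ((1 - δ / 2) * (n : ℝ)))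
    (hratio : r_o * (1 - ε ^ 2 / 2) ≤ (1 + ε) * r_c) :
    (1 - ε) * MEBRadius (P : Set (EuclideanSpace ℝ (Fin d))) <
      PartialRadius P ((1 - δ / 2) * (n : ℝ)) := by
  have hR : MEBRadius (P : Set (EuclideanSpace ℝ (Fin d))) ≤ r_o :=
    MEBRadius_le_of_subset_closedBall hro0.le hocover
  refine (mul_le_mul_of_nonneg_left hR (sub_nonneg.2 hε1.le)).trans_lt ?_
  have hpos : 0 < (1 + ε) * (1 + ε ^ 2 / 2) := by positivity
  refine lt_of_mul_lt_mul_left ?_ hpos.le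
  have hε4 : 0 < r_o * ε ^ 4 := by positivity
  calc (1 + ε) * (1 + ε ^ 2 / 2) * ((1 - ε) * r_o)
      = r_o * (1 - ε ^ 2 / 2) - r_o * ε ^ 4 / 2 := by ring
    _ < r_o * (1 - ε ^ 2 / 2) := by linarith
    _ ≤ (1 + ε) * r_c := hratio
    _ ≤ (1 + ε) * ((1 + ε ^ 2 / 2) * PartialRadius P ((1 - δ / 2) * (n : ℝ))) := by gcongr
    _ = (1 + ε) * (1 + ε ^ 2 / 2) * PartialRadius P ((1 - δ / 2) * (n : ℝ)) := by ring
end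

section
/- Let γ, α, β ∈ (0,1) with β < 1−γ. Let P ⊆ E be finite with n = |P|, and let P_opt ⊆ P be nonempty with |P_opt| = (1−γ)·n. Suppose that for every Q ⊆ P with |Q| < (γ+β)·n, every closed ball containing P∖Q has radius greater than (1−α)·Rad(P_opt). Then for every Q′ ⊆ P_opt with |Q′| < (β/(1−γ))·|P_opt|, every closed ball containing P_opt∖Q′ has radius greater than (1−α)·Rad(P_opt); that is, P_opt is an (α, β̃)-stable instance of MEB with β̃ ≥ β/(1−γ). -/
open Metric

/-- Claim 2 of the paper: if the MEB-with-outliers instance `(P, γ)` with optimal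
inlier set `P_opt` (of size `(1-γ)·n`) is `(α, β)`-stable — i.e. removing fewer
than `(γ+β)·n` points of `P` cannot reduce the covering radius to
`(1-α)·Rad(P_opt)` — then `P_opt` is an `(α, β̃)`-stable instance of MEB with
`β̃ ≥ β/(1-γ)`: removing fewer than `(β/(1-γ))·|P_opt|` points of `P_opt` cannot
reduce its covering radius to `(1-α)·Rad(P_opt)`. -/
theorem stability_transfer {d : ℕ} (hd : 1 ≤ d)
    (γ α β : ℝ) (hγ0 : 0 < γ) (hγ1 : γ < 1) (hα0 : 0 < α) (hα1 : α < 1)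
    (hβ0 : 0 < β) (hβ : β < 1 - γ)
    (P : Finset (EuclideanSpace ℝ (Fin d))) (n : ℕ) (hn : P.card = n)
    (Popt : Finset (EuclideanSpace ℝ (Fin d))) (hPoptP : Popt ⊆ P)
    (hPopt : Popt.Nonempty) (hPoptcard : (Popt.card : ℝ) = (1 - γ) * (n : ℝ))
    (hstable : ∀ Q : Finset (EuclideanSpace ℝ (Fin d)), Q ⊆ P →
      (Q.card : ℝ) < (γ + β) * (n : ℝ) →
      ∀ (c : EuclideanSpace ℝ (Fin d)) (r : ℝ),
        ((P : Set (EuclideanSpace ℝ (Fin d))) \ (Q : Set (EuclideanSpace ℝ (Fin d))))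
          ⊆ closedBall c r →
        (1 - α) * MEBRadius (Popt : Set (EuclideanSpace ℝ (Fin d))) < r) :
    ∀ Q' : Finset (EuclideanSpace ℝ (Fin d)), Q' ⊆ Popt →
      (Q'.card : ℝ) < (β / (1 - γ)) * (Popt.card : ℝ) →
      ∀ (c : EuclideanSpace ℝ (Fin d)) (r : ℝ),
        ((Popt : Set (EuclideanSpace ℝ (Fin d))) \ (Q' : Set (EuclideanSpace ℝ (Fin d))))
          ⊆ closedBall c r →
        (1 - α) * MEBRadius (Popt : Set (EuclideanSpace ℝ (Fin d))) < r := by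
  classical
  intro Q' hQ' hcard c r hball
  have hinliers : Popt \ Q' ⊆ P := Finset.sdiff_subset.trans hPoptP
  refine hstable (P \ (Popt \ Q')) Finset.sdiff_subset ?_ c r ?_
  · have h : β / (1 - γ) * (Popt.card : ℝ) = β * n := by
      rw [hPoptcard]
      field_simp [(sub_pos.2 hγ1).ne']
    rw [Finset.cast_card_sdiff hinliers, Finset.cast_card_sdiff hQ', hn]
    linarith
  · rwa [← Finset.coe_sdiff, Finset.sdiff_sdiff_eq_self hinliers, Finset.coe_sdiff]
end

section
/- Let P be a finite set, let f : P → ℝ, let P_opt ⊆ P, let A ⊆ P with n′ = |A|, and let δ, γ > 0. Let l, l′ ∈ ℝ and define Q = {p ∈ P : f p > l} and Q′ = {p ∈ A : f p > l′}. Suppose |Q′| = (3/2)(δ+γ)·n′, |A ∩ Q| < (3/2)(δ+γ)·n′, and |A ∩ (P_opt ∩ Q)| > (1/2)·δ·n′. Then Q′ ∩ (P_opt ∩ Q) = A ∩ (P_opt ∩ Q), and consequently |Q′ ∩ (P_opt ∩ Q)| / |Q′| ≥ δ/(3(γ+δ)). -/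
/-- The deterministic core of Lemma 13 of the paper (the Generalized
Uniform-Adaptive Sampling lemma for minimum enclosing "x" with outliers): `f p`
plays the role of the distance from `p` to the current shape center, `Q` is the
set of points of `P` with `f`-value above `l`, `A ⊆ P` a sample of size `n'`, and
`Q'` the set of points of `A` with `f`-value above `l'`.  If
`|Q'| = (3/2)(δ+γ)·n'`, `|A ∩ Q| < (3/2)(δ+γ)·n'`, and
`|A ∩ (P_opt ∩ Q)| > δ·n'/2`, then `Q' ∩ (P_opt ∩ Q) = A ∩ (P_opt ∩ Q)` and
`|Q' ∩ (P_opt ∩ Q)| / |Q'| ≥ δ/(3(γ+δ))`. -/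
theorem generalized_uniform_adaptive_sampling_core {α : Type*}
    (P : Set α) (hPfin : P.Finite) (f : α → ℝ)
    (Popt : Set α) (hPopt : Popt ⊆ P)
    (δ γ : ℝ) (hδ : 0 < δ) (hγ : 0 < γ)
    (A : Set α) (hA : A ⊆ P) (n' : ℕ) (hn' : A.ncard = n')
    (l l' : ℝ) (Q Q' : Set α)
    (hQ : Q = {p ∈ P | l < f p})
    (hQ' : Q' = {p ∈ A | l' < f p})
    (hQ'card : (Q'.ncard : ℝ) = (3 / 2) * (δ + γ) * (n' : ℝ))
    (hAQ : ((A ∩ Q).ncard : ℝ) < (3 / 2) * (δ + γ) * (n' : ℝ))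
    (hhit : (1 / 2) * δ * (n' : ℝ) < ((A ∩ (Popt ∩ Q)).ncard : ℝ)) :
    Q' ∩ (Popt ∩ Q) = A ∩ (Popt ∩ Q) ∧
      δ / (3 * (γ + δ)) ≤ ((Q' ∩ (Popt ∩ Q)).ncard : ℝ) / (Q'.ncard : ℝ) := by
  have hlt : l' < l := by
    by_contra! h
    have hsub : Q' ⊆ A ∩ Q := by
      rw [hQ, hQ']
      exact fun p hp => ⟨hp.1, hA hp.1, h.trans_lt hp.2⟩
    have hcard : (Q'.ncard : ℝ) ≤ ((A ∩ Q).ncard : ℝ) := by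
      exact_mod_cast Set.ncard_le_ncard hsub ((hPfin.subset hA).inter_of_left Q)
    linarith
  have heq : Q' ∩ (Popt ∩ Q) = A ∩ (Popt ∩ Q) := by
    rw [hQ, hQ']
    ext p
    exact ⟨fun hp => ⟨hp.1.1, hp.2⟩, fun hp => ⟨⟨hp.1, hlt.trans hp.2.2.2⟩, hp.2⟩⟩
  refine ⟨heq, ?_⟩
  have hpos : 0 < (3 / 2) * (δ + γ) * (n' : ℝ) := (Nat.cast_nonneg _).trans_lt hAQ
  rw [heq, hQ'card, div_le_div_iff₀ (by positivity) hpos]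
  calc δ * ((3 / 2) * (δ + γ) * (n' : ℝ))
      = (1 / 2) * δ * (n' : ℝ) * (3 * (γ + δ)) := by ring
    _ ≤ ((A ∩ (Popt ∩ Q)).ncard : ℝ) * (3 * (γ + δ)) := by gcongr
end
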